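/- Let G=(V,E) be a finite connected graph, let L be a laminar family of subsets of V, let c : E → ℝ≥0 be edge costs, and let x be a point of the spanning tree polytope of G that is L-aligned, i.e., for every S ∈ L the restriction of x to E(S) lies in the spanning tree polytope of the induced subgraph G[S]. Then there exists a spanning tree T of G such that Σ_{e∈T} c(e) ≤ Σ_{e∈E} c(e)·x(e), and for every S ∈ L, |T ∩ δ(S)| ≤ 2·⌈x(δ(S))⌉ + 1 ≤ 2·x(δ(S)) + 3. -/

import Mathlib

open scoped Classical
open Finset

noncomputable section

variable {V : Type}

/-- The set of edges of `G` with exactly one endpoint in `S`. -/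
def cutEdges [Fintype V] (G : SimpleGraph V) (S : Set V) : Finset (Sym2 V) :=
  Finset.univ.filter (fun e => e ∈ G.edgeSet ∧ ∃ u v, e = s(u, v) ∧ u ∈ S ∧ v ∉ S)

/-- The set of edges of `G` with both endpoints in `S`. -/
def insideEdges [Fintype V] (G : SimpleGraph V) (S : Set V) : Finset (Sym2 V) :=
  Finset.univ.filter (fun e => e ∈ G.edgeSet ∧ ∀ v ∈ e, v ∈ S)

/-- A family of sets is laminar if any two members are disjoint or nested. -/
def Laminar (L : Set (Set V)) : Prop :=
  ∀ S T, S ∈ L → T ∈ L → S ∩ T = ∅ ∨ S ∩ T = S ∨ S ∩ T = T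

/-- The spanning tree polytope of `G` : the convex hull of the indicator vectors of
the edge sets of spanning trees of `G`. -/
def stPolytope [Fintype V] (G : SimpleGraph V) : Set (Sym2 V → ℝ) :=
  convexHull ℝ { y | ∃ T : SimpleGraph V, T ≤ G ∧ T.IsTree ∧
      y = fun e => if e ∈ T.edgeSet then (1 : ℝ) else 0 }

/-- `x` is `L`-aligned: for every `S ∈ L`, the restriction of `x` to `E(S)` lies in the
spanning tree polytope of the induced subgraph `G[S]`. -/
def IsAligned [Fintype V] (G : SimpleGraph V) (L : Set (Set V)) (x : Sym2 V → ℝ) : Prop :=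
  ∀ S ∈ L, (fun e : Sym2 S => x (e.map Subtype.val)) ∈ stPolytope (G.induce S)

/-- The pairs with both endpoints in `U`. -/
def inside [Fintype V] (U : Finset V) : Finset (Sym2 V) :=
  univ.filter fun e => ∀ v ∈ e, v ∈ U

/-- The pairs with exactly one endpoint in `U`. -/
def crossing [Fintype V] (U : Finset V) : Finset (Sym2 V) :=
  univ.filter fun e => ∃ u v, e = s(u, v) ∧ u ∈ U ∧ v ∉ U

/-- The number of endpoints of `e` in `U`. -/
def mult (U : Finset V) (e : Sym2 V) : ℤ := #(U.filter (· ∈ e))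

/-- The maximal members of `N` properly contained in `S`. -/
def children (N : Finset (Finset V)) (S : Finset V) : Finset (Finset V) :=
  N.filter fun C => C ⊂ S ∧ ∀ R ∈ N, C ⊂ R → ¬ R ⊂ S

/-- The pairs inside `S` that are not inside a child of `S`. -/
def level [Fintype V] (N : Finset (Finset V)) (S : Finset V) : Finset (Sym2 V) :=
  (inside S).filter fun e => ∀ C ∈ children N S, e ∉ inside C

theorem mem_inside [Fintype V] {U : Finset V} {e : Sym2 V} :
    e ∈ inside U ↔ ∀ v ∈ e, v ∈ U := by simp [inside]

theorem mk_mem_inside [Fintype V] {U : Finset V} {a b : V} :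
    s(a, b) ∈ inside U ↔ a ∈ U ∧ b ∈ U := by simp [inside]

theorem mk_mem_crossing [Fintype V] {U : Finset V} {a b : V} :
    s(a, b) ∈ crossing U ↔ (a ∈ U ∧ b ∉ U) ∨ (b ∈ U ∧ a ∉ U) := by
  simp only [crossing, mem_filter, mem_univ, true_and, Sym2.eq_iff]
  grind

theorem mult_nonneg (U : Finset V) (e : Sym2 V) : 0 ≤ mult U e := by simp [mult]

theorem mult_mk {a b : V} (hab : a ≠ b) (U : Finset V) :
    mult U s(a, b) = (if a ∈ U then 1 else 0) + (if b ∈ U then 1 else 0) := by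
  have h : U.filter (· ∈ s(a, b)) = ({a} : Finset V).filter (· ∈ U) ∪
      ({b} : Finset V).filter (· ∈ U) := by
    ext v; simp only [Sym2.mem_iff, mem_filter, mem_union, mem_singleton]; grind
  have hd : Disjoint (({a} : Finset V).filter (· ∈ U)) (({b} : Finset V).filter (· ∈ U)) := by
    rw [Finset.disjoint_left]; simp only [mem_filter, mem_singleton]; grind
  rw [mult, h, card_union_of_disjoint hd, filter_singleton, filter_singleton]
  split_ifs <;> simp

theorem mult_eq [Fintype V] {e : Sym2 V} (he : ¬ e.IsDiag) (U : Finset V) :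
    mult U e = (if e ∈ crossing U then 1 else 0) + 2 * (if e ∈ inside U then 1 else 0) := by
  induction e with | _ a b
  rw [mult_mk (by simpa using he)]
  simp only [mk_mem_crossing, mk_mem_inside]
  by_cases ha : a ∈ U <;> by_cases hb : b ∈ U <;> simp [ha, hb]

section Laminar

variable {N : Finset (Finset V)} {S : Finset V}

theorem mem_children {C : Finset V} : C ∈ children N S ↔
    C ∈ N ∧ C ⊂ S ∧ ∀ R ∈ N, C ⊂ R → ¬ R ⊂ S := by
  simp [children]

theorem exists_child {R : Finset V} (hR : R ∈ N) (hRS : R ⊂ S) : ∃ C ∈ children N S, R ⊆ C := by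
  obtain ⟨C, hRC, hC⟩ := (N.filter (· ⊂ S)).finite_toSet.exists_le_maximal
    (a := R) (by simp [hR, hRS])
  have hCm := hC.prop
  simp only [coe_filter, Set.mem_ofPred_eq] at hCm
  refine ⟨C, mem_children.2 ⟨hCm.1, hCm.2, fun R' hR' hCR' hR'S => ?_⟩, hRC⟩
  exact hCR'.not_subset (hC.le_of_ge (by simp [hR', hR'S]) hCR'.le)

theorem children_subset : children N S ⊆ N := filter_subset _ _

theorem ssubset_of_mem_children {C : Finset V} (hC : C ∈ children N S) : C ⊂ S :=
  (mem_children.1 hC).2.1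

theorem children_disjoint
    (hN : ∀ A ∈ N, ∀ B ∈ N, Disjoint A B ∨ A ⊆ B ∨ B ⊆ A) {C D : Finset V}
    (hC : C ∈ children N S) (hD : D ∈ children N S) (h : C ≠ D) : Disjoint C D := by
  obtain ⟨hC1, hC2, hC3⟩ := mem_children.1 hC
  obtain ⟨hD1, hD2, hD3⟩ := mem_children.1 hD
  rcases hN C hC1 D hD1 with h' | h' | h'
  · exact h'
  · exact absurd hD2 (hC3 D hD1 (h'.ssubset_of_ne h))
  · exact absurd hC2 (hD3 C hC1 (h'.ssubset_of_ne h.symm))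

theorem children_pairwiseDisjoint (hN : ∀ A ∈ N, ∀ B ∈ N, Disjoint A B ∨ A ⊆ B ∨ B ⊆ A) :
    (children N S : Set (Finset V)).PairwiseDisjoint id :=
  fun _ hC _ hD h => children_disjoint hN hC hD h

theorem exists_mem_child (hs : ∀ v : V, {v} ∈ N) (hS : 2 ≤ #S) {v : V} (hv : v ∈ S) :
    ∃ C ∈ children N S, v ∈ C := by
  obtain ⟨C, hC, h⟩ := exists_child (S := S) (hs v)
    ((singleton_subset_iff.2 hv).ssubset_of_ne (by rintro rfl; simp at hS))
  exact ⟨C, hC, h (mem_singleton_self v)⟩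

theorem biUnion_children (hs : ∀ v : V, {v} ∈ N) (hS : 2 ≤ #S) :
    (children N S).biUnion id = S := by
  ext v
  simp only [mem_biUnion, id]
  exact ⟨fun ⟨C, hC, hv⟩ => (ssubset_of_mem_children hC).subset hv, exists_mem_child hs hS⟩

theorem two_le_card_children (hs : ∀ v : V, {v} ∈ N) (hS : 2 ≤ #S) : 2 ≤ #(children N S) := by
  obtain ⟨v, hv⟩ : S.Nonempty := card_pos.1 (by omega)
  obtain ⟨A, hA, -⟩ := exists_mem_child hs hS hv
  obtain ⟨w, hw, hwA⟩ := exists_of_ssubset (ssubset_of_mem_children hA)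
  obtain ⟨B, hB, hwB⟩ := exists_mem_child hs hS hw
  rw [← card_pair (show A ≠ B by rintro rfl; exact hwA hwB)]
  exact card_le_card (by simp [insert_subset_iff, hA, hB])

theorem sum_children (hN : ∀ A ∈ N, ∀ B ∈ N, Disjoint A B ∨ A ⊆ B ∨ B ⊆ A)
    (hs : ∀ v : V, {v} ∈ N) (hS : 2 ≤ #S) {M : Type*} [AddCommMonoid M] (f : V → M) :
    ∑ v ∈ S, f v = ∑ C ∈ children N S, ∑ v ∈ C, f v := by
  conv_lhs => rw [← biUnion_children hs hS]
  exact sum_biUnion (children_pairwiseDisjoint hN)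

theorem mult_eq_sum (U : Finset V) (e : Sym2 V) :
    mult U e = ∑ v ∈ U, if v ∈ e then 1 else 0 := by
  simp [mult]

theorem mult_children (hN : ∀ A ∈ N, ∀ B ∈ N, Disjoint A B ∨ A ⊆ B ∨ B ⊆ A)
    (hs : ∀ v : V, {v} ∈ N) (hS : 2 ≤ #S) (e : Sym2 V) :
    mult S e = ∑ C ∈ children N S, mult C e := by
  simp only [mult_eq_sum]
  exact sum_children hN hs hS _

theorem card_descendants (hN : ∀ A ∈ N, ∀ B ∈ N, Disjoint A B ∨ A ⊆ B ∨ B ⊆ A)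
    (hne : ∀ A ∈ N, A.Nonempty) {D : Finset (Finset V)} (hD : D ⊆ N) :
    #(D.filter (· ⊂ S)) = ∑ C ∈ children N S, #(D.filter (· ⊆ C)) := by
  rw [← card_biUnion]
  · congr 1
    ext R
    simp only [mem_filter, mem_biUnion]
    constructor
    · rintro ⟨hR, hRS⟩
      obtain ⟨C, hC, h⟩ := exists_child (hD hR) hRS
      exact ⟨C, hC, hR, h⟩
    · rintro ⟨C, hC, hR, h⟩
      exact ⟨hR, h.trans_ssubset (ssubset_of_mem_children hC)⟩
  · intro A hA B hB hAB
    rw [Function.onFun, Finset.disjoint_left]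
    intro R h1 h2
    obtain ⟨v, hv⟩ := hne R (hD (mem_filter.1 h1).1)
    exact Finset.disjoint_left.1 (children_disjoint hN hA hB hAB) ((mem_filter.1 h1).2 hv)
      ((mem_filter.1 h2).2 hv)

theorem filter_ssubset_eq_empty {D : Finset (Finset V)} (hD : D ⊆ N)
    (h : ∀ C ∈ children N S, D.filter (· ⊆ C) = ∅) : D.filter (· ⊂ S) = ∅ := by
  refine filter_eq_empty_iff.2 fun R hR hRS => ?_
  obtain ⟨C, hC, hRC⟩ := exists_child (hD hR) hRS
  exact filter_eq_empty_iff.1 (h C hC) hR hRC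

theorem inside_mono [Fintype V] {A B : Finset V} (h : A ⊆ B) : inside A ⊆ inside B :=
  fun _ he => mem_inside.2 fun v hv => h (mem_inside.1 he v hv)

theorem inside_disjoint [Fintype V] {A B : Finset V} (h : Disjoint A B) :
    Disjoint (inside A) (inside B) := by
  rw [Finset.disjoint_left]
  intro e hA hB
  induction e with | _ a b
  exact Finset.disjoint_left.1 h (mk_mem_inside.1 hA).1 (mk_mem_inside.1 hB).1

theorem sum_inside [Fintype V] (hN : ∀ A ∈ N, ∀ B ∈ N, Disjoint A B ∨ A ⊆ B ∨ B ⊆ A)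
    {M : Type*} [AddCommMonoid M] (f : Sym2 V → M) :
    ∑ e ∈ inside S, f e =
      ∑ e ∈ level N S, f e + ∑ C ∈ children N S, ∑ e ∈ inside C, f e := by
  rw [level, ← sum_biUnion (fun A hA B hB h => inside_disjoint (children_disjoint hN hA hB h)),
    ← sum_filter_add_sum_filter_not (inside S) (fun e => ∀ C ∈ children N S, e ∉ inside C)]
  congr 2
  ext e
  simp only [mem_filter, mem_biUnion, not_forall, not_not, exists_prop]
  exact ⟨fun h => h.2, fun ⟨C, hC, h⟩ =>
    ⟨inside_mono (ssubset_of_mem_children hC).subset h, C, hC, h⟩⟩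

theorem crossing_child_mem_level [Fintype V]
    (hN : ∀ A ∈ N, ∀ B ∈ N, Disjoint A B ∨ A ⊆ B ∨ B ⊆ A) {C : Finset V}
    (hC : C ∈ children N S) {e : Sym2 V} (he : e ∈ crossing C) (heS : e ∈ inside S) :
    e ∈ level N S := by
  refine mem_filter.2 ⟨heS, fun D hD heD => ?_⟩
  induction e with | _ a b
  rw [mk_mem_crossing] at he
  rw [mk_mem_inside] at heD
  rcases eq_or_ne C D with rfl | h
  · grind
  · have := Finset.disjoint_left.1 (children_disjoint hN hC hD h)
    grind

end Laminar

/-- Nonnegative loopless vectors satisfying the subtour elimination constraints. -/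
structure IsForestPoint [Fintype V] (y : Sym2 V → ℝ) : Prop where
  nonneg : ∀ e, 0 ≤ y e
  diag : ∀ e, e.IsDiag → y e = 0
  sum_inside_le : ∀ U : Finset V, U.Nonempty → ∑ e ∈ inside U, y e ≤ #U - 1

/-- The subtour elimination constraint of `U` holds with equality. -/
def IsTight [Fintype V] (y : Sym2 V → ℝ) (U : Finset V) : Prop :=
  U.Nonempty ∧ ∑ e ∈ inside U, y e = #U - 1

/-- The pairs on which `y` lies strictly between zero and one. -/
def frac [Fintype V] (y : Sym2 V → ℝ) : Finset (Sym2 V) := univ.filter fun e => 0 < y e ∧ y e < 1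

/-- The sets `A` and `B` intersect and neither contains the other. -/
def Crosses (A B : Finset V) : Prop := ¬ Disjoint A B ∧ ¬ A ⊆ B ∧ ¬ B ⊆ A

/-- A maximal laminar family of tight sets, containing all singletons and the whole vertex set. -/
structure IsTightFamily [Fintype V] (y : Sym2 V → ℝ) (N : Finset (Finset V)) : Prop where
  laminar : ∀ A ∈ N, ∀ B ∈ N, Disjoint A B ∨ A ⊆ B ∨ B ⊆ A
  tight : ∀ A ∈ N, IsTight y A
  singleton_mem : ∀ v : V, {v} ∈ N
  maximal : ∀ U, IsTight y U → (∀ R ∈ N, ¬ Crosses R U) → U ∈ N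

section Points

variable [Fintype V] {y : Sym2 V → ℝ}

theorem mem_frac {e : Sym2 V} : e ∈ frac y ↔ 0 < y e ∧ y e < 1 := by simp [frac]

theorem IsForestPoint.not_isDiag (hy : IsForestPoint y) {e : Sym2 V} (he : 0 < y e) :
    ¬ e.IsDiag := fun h => he.ne' (hy.diag e h)

theorem IsForestPoint.le_one (hy : IsForestPoint y) (e : Sym2 V) : y e ≤ 1 := by
  by_cases hd : e.IsDiag
  · rw [hy.diag e hd]; exact zero_le_one
  induction e with | _ a b
  have hab : a ≠ b := by simpa using hd
  have h := hy.sum_inside_le {a, b} (by simp)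
  rw [card_pair hab] at h
  have h2 := single_le_sum (f := y) (fun e _ => hy.nonneg e)
    (show s(a, b) ∈ inside {a, b} from mk_mem_inside.2 (by simp))
  push_cast at h
  linarith

theorem IsForestPoint.isTight_singleton (hy : IsForestPoint y) (v : V) : IsTight y {v} := by
  refine ⟨singleton_nonempty v, ?_⟩
  rw [sum_eq_zero]
  · simp
  · intro e he
    induction e with | _ a b
    have := mk_mem_inside.1 he
    simp only [mem_singleton] at this
    exact hy.diag _ (by simp [this.1, this.2])

theorem exists_isTightFamily (hy : IsForestPoint y) {N : Finset (Finset V)}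
    (hN : ∀ A ∈ N, ∀ B ∈ N, Disjoint A B ∨ A ⊆ B ∨ B ⊆ A) (ht : ∀ A ∈ N, IsTight y A) :
    ∃ N', N ⊆ N' ∧ IsTightFamily y N' := by
  obtain ⟨M, hNM, hM⟩ := Finite.exists_le_maximal (a := N) (p := fun M : Finset (Finset V) =>
    (∀ A ∈ M, ∀ B ∈ M, Disjoint A B ∨ A ⊆ B ∨ B ⊆ A) ∧ ∀ A ∈ M, IsTight y A) ⟨hN, ht⟩
  have hmax : ∀ U, IsTight y U → (∀ R ∈ M, ¬ Crosses R U) → U ∈ M := by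
    intro U hU hc
    refine hM.le_of_ge (y := insert U M) ⟨?_, ?_⟩ (subset_insert _ _) (mem_insert_self _ _)
    · intro A hA B hB
      have h1 := hM.prop.1
      simp only [Crosses] at hc
      rw [mem_insert] at hA hB
      rcases hA with rfl | hA <;> rcases hB with rfl | hB
      · exact Or.inr (Or.inl subset_rfl)
      · have := hc B hB; have := disjoint_comm (a := A) (b := B); tauto
      · have := hc A hA; tauto
      · exact h1 A hA B hB
    · intro A hA
      rw [mem_insert] at hA
      rcases hA with rfl | hA
      · exact hU
      · exact hM.prop.2 A hA
  refine ⟨M, hNM, hM.prop.1, hM.prop.2, fun v => hmax _ (hy.isTight_singleton v) ?_, hmax⟩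
  rintro R - ⟨h1, h2, h3⟩
  exact h1 (disjoint_singleton_right.2 fun h => h3 (singleton_subset_iff.2 h))

theorem IsTightFamily.univ_mem {N : Finset (Finset V)} (hN : IsTightFamily y N)
    (hu : IsTight y univ) : univ ∈ N :=
  hN.maximal _ hu fun _ _ h => h.2.1 (subset_univ _)

theorem indicator_inside_add_le (A B : Finset V) (e : Sym2 V) :
    ((if e ∈ inside A then 1 else 0) + if e ∈ inside B then 1 else 0 : ℝ) ≤
      (if e ∈ inside (A ∩ B) then 1 else 0) + if e ∈ inside (A ∪ B) then 1 else 0 := by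
  induction e with | _ a b
  simp only [mk_mem_inside, mem_inter, mem_union]
  by_cases h1 : a ∈ A <;> by_cases h2 : b ∈ A <;> by_cases h3 : a ∈ B <;> by_cases h4 : b ∈ B <;>
    simp [h1, h2, h3, h4]

theorem sum_inside_eq (f : Sym2 V → ℝ) (A : Finset V) :
    ∑ e ∈ inside A, f e = ∑ e, (if e ∈ inside A then 1 else 0) * f e := by
  simp [Finset.sum_ite_mem]

/-- Uncrossing of two tight sets. -/
theorem IsForestPoint.uncross (hy : IsForestPoint y) {A B : Finset V} (hA : IsTight y A)
    (hB : IsTight y B) (hAB : (A ∩ B).Nonempty) :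
    IsTight y (A ∩ B) ∧ IsTight y (A ∪ B) ∧
      ∀ d : Sym2 V → ℝ, (∀ e, y e = 0 → d e = 0) →
        ∑ e ∈ inside A, d e + ∑ e ∈ inside B, d e =
          ∑ e ∈ inside (A ∩ B), d e + ∑ e ∈ inside (A ∪ B), d e := by
  have hU : (A ∪ B).Nonempty := hA.1.mono subset_union_left
  have h1 := hy.sum_inside_le _ hAB
  have h2 := hy.sum_inside_le _ hU
  have hc : (#(A ∪ B) : ℝ) + #(A ∩ B) = #A + #B := by exact_mod_cast card_union_add_card_inter A B
  have hle : ∀ e ∈ (univ : Finset (Sym2 V)),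
      ((if e ∈ inside A then 1 else 0) + if e ∈ inside B then 1 else 0 : ℝ) * y e ≤
      ((if e ∈ inside (A ∩ B) then 1 else 0) + if e ∈ inside (A ∪ B) then 1 else 0) * y e :=
    fun e _ => mul_le_mul_of_nonneg_right (indicator_inside_add_le A B e) (hy.nonneg e)
  have hs := sum_le_sum hle
  have hA' := hA.2
  have hB' := hB.2
  have key := sum_eq_sum_iff_of_le hle
  simp only [add_mul, sum_add_distrib, ← sum_inside_eq] at hs key
  refine ⟨⟨hAB, by linarith⟩, ⟨hU, by linarith⟩, fun d hd => ?_⟩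
  have heq := key.1 (by linarith)
  simp only [sum_inside_eq, ← sum_add_distrib, ← add_mul]
  refine sum_congr rfl fun e he => ?_
  by_cases hz : y e = 0
  · simp [hd e hz]
  · have := heq e he
    rw [← add_mul, ← add_mul] at this
    rw [mul_right_cancel₀ hz this]

theorem IsTightFamily.sum_inside_eq_zero (hy : IsForestPoint y) {N : Finset (Finset V)}
    (hN : IsTightFamily y N) {d : Sym2 V → ℝ} (hd : ∀ e, y e = 0 → d e = 0)
    (hdN : ∀ R ∈ N, ∑ e ∈ inside R, d e = 0) {U : Finset V} (hU : IsTight y U) :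
    ∑ e ∈ inside U, d e = 0 := by
  induction hn : #(N.filter fun R => Crosses R U) using Nat.strong_induction_on generalizing U with
  | _ n ih
  by_cases hc : ∀ R ∈ N, ¬ Crosses R U
  · exact hdN U (hN.maximal U hU hc)
  push Not at hc
  obtain ⟨R, hR, hRU⟩ := hc
  have hne : (U ∩ R).Nonempty := by
    rw [← not_disjoint_iff_nonempty_inter, disjoint_comm]; exact hRU.1
  obtain ⟨hI, hJ, hsum⟩ := hy.uncross hU (hN.tight R hR) hne
  have hlt : ∀ W, (∀ R' ∈ N, Crosses R' W → Crosses R' U) → ¬ Crosses R W →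
      #(N.filter fun R => Crosses R W) < n := by
    intro W h1 h2
    rw [← hn]
    refine card_lt_card ⟨fun R' h => ?_, fun h => ?_⟩
    · rw [mem_filter] at h ⊢
      exact ⟨h.1, h1 R' h.1 h.2⟩
    · exact h2 (mem_filter.1 (h (mem_filter.2 ⟨hR, hRU⟩))).2
  have h1 := ih _ (hlt (U ∩ R) ?_ ?_) hI rfl
  have h2 := ih _ (hlt (U ∪ R) ?_ ?_) hJ rfl
  · linarith [hsum d hd, hdN R hR]
  · intro R' hR' h
    have hl := hN.laminar R hR R' hR'
    simp only [Crosses, Finset.disjoint_left, Finset.subset_iff] at *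
    grind
  · exact fun h => h.2.1 subset_union_right
  · intro R' hR' h
    have hl := hN.laminar R hR R' hR'
    simp only [Crosses, Finset.disjoint_left, Finset.subset_iff] at *
    grind
  · exact fun h => h.2.2 inter_subset_right

end Points

section Levels

variable [Fintype V] {y : Sym2 V → ℝ} {N : Finset (Finset V)} {S : Finset V}

theorem two_le_card_of_mem_inside {e : Sym2 V} (hd : ¬ e.IsDiag) (he : e ∈ inside S) :
    2 ≤ #S := by
  induction e with | _ a b
  have hab : a ≠ b := by simpa using hd
  rw [← card_pair hab]
  have := mk_mem_inside.1 he
  exact card_le_card (by simp [insert_subset_iff, this.1, this.2])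

theorem IsForestPoint.sum_inside_add_le (hy : IsForestPoint y) {A B : Finset V}
    (hAB : Disjoint A B) {K : Finset (Sym2 V)} (hK : K ⊆ inside (A ∪ B))
    (hA : Disjoint K (inside A)) (hB : Disjoint K (inside B)) :
    ∑ e ∈ inside A, y e + ∑ e ∈ inside B, y e + ∑ e ∈ K, y e ≤ ∑ e ∈ inside (A ∪ B), y e := by
  rw [← sum_union (inside_disjoint hAB), ← sum_union (disjoint_union_left.2 ⟨hA.symm, hB.symm⟩)]
  exact sum_le_sum_of_subset_of_nonneg (union_subset (union_subset
    (inside_mono subset_union_left) (inside_mono subset_union_right)) hK)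
    fun e _ _ => hy.nonneg e

theorem exists_children_of_mem_level (hs : ∀ v : V, {v} ∈ N) {e : Sym2 V} (hd : ¬ e.IsDiag)
    (he : e ∈ level N S) :
    ∃ A ∈ children N S, ∃ B ∈ children N S, A ≠ B ∧ e ∈ inside (A ∪ B) := by
  have heS := (mem_filter.1 he).1
  have hS := two_le_card_of_mem_inside hd heS
  induction e with | _ a b
  obtain ⟨A, hA, ha⟩ := exists_mem_child hs hS (mk_mem_inside.1 heS).1
  obtain ⟨B, hB, hb⟩ := exists_mem_child hs hS (mk_mem_inside.1 heS).2
  refine ⟨A, hA, B, hB, ?_, mk_mem_inside.2 ⟨mem_union_left _ ha, mem_union_right _ hb⟩⟩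
  rintro rfl
  exact (mem_filter.1 he).2 A hA (mk_mem_inside.2 ⟨ha, hb⟩)

theorem not_crosses_union_children (hN : IsTightFamily y N) (hS : S ∈ N) {A B : Finset V}
    (hA : A ∈ children N S) (hB : B ∈ children N S) {R : Finset V} (hR : R ∈ N) :
    ¬ Crosses R (A ∪ B) := by
  rintro ⟨h1, h2, h3⟩
  have hAS := (ssubset_of_mem_children hA).subset
  have hBS := (ssubset_of_mem_children hB).subset
  have key : ∀ C ∈ children N S, C ⊆ A ∪ B → ¬ Disjoint R C → False := by
    intro C hC hCAB hRC
    rcases hN.laminar R hR C (children_subset hC) with h | h | h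
    · exact hRC h
    · exact h2 (h.trans hCAB)
    · have hCR : C ⊂ R := h.ssubset_of_ne (by rintro rfl; exact h2 hCAB)
      have hRS := (mem_children.1 hC).2.2 R hR hCR
      rcases hN.laminar R hR S hS with h' | h' | h'
      · exact hRC (h'.mono_right (ssubset_of_mem_children hC).subset)
      · rcases eq_or_ne R S with rfl | hne
        · exact h3 (union_subset hAS hBS)
        · exact hRS (h'.ssubset_of_ne hne)
      · exact h3 ((union_subset hAS hBS).trans h')
  rw [disjoint_union_right, not_and_or] at h1
  rcases h1 with h1 | h1
  · exact key A hA subset_union_left h1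
  · exact key B hB subset_union_right h1

/-- If a level carries a fractional pair then its whole support is fractional. -/
theorem mem_frac_of_mem_level (hy : IsForestPoint y) (hN : IsTightFamily y N) (hS : S ∈ N)
    {e g : Sym2 V} (he : e ∈ frac y) (heS : e ∈ level N S) (hg : 0 < y g) (hgS : g ∈ level N S) :
    g ∈ frac y := by
  refine mem_frac.2 ⟨hg, lt_of_le_of_ne (hy.le_one g) fun hg1 => ?_⟩
  obtain ⟨A, hA, B, hB, hAB, hgAB⟩ :=
    exists_children_of_mem_level hN.singleton_mem (hy.not_isDiag hg) hgS
  have hdisj := children_disjoint hN.laminar hA hB hAB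
  have htA := hN.tight A (children_subset hA)
  have htB := hN.tight B (children_subset hB)
  have hcard : (#(A ∪ B) : ℝ) = #A + #B := by exact_mod_cast card_union_of_disjoint hdisj
  have hlev : ∀ K ⊆ level N S, ∀ C ∈ children N S, Disjoint K (inside C) := fun K hK C hC =>
    Finset.disjoint_left.2 fun f hf => (mem_filter.1 (hK hf)).2 C hC
  have hne : (A ∪ B).Nonempty := htA.1.mono subset_union_left
  have hUB := hy.sum_inside_le _ hne
  have h1 := hy.sum_inside_add_le hdisj (singleton_subset_iff.2 hgAB)
    (hlev _ (singleton_subset_iff.2 hgS) A hA) (hlev _ (singleton_subset_iff.2 hgS) B hB)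
  rw [sum_singleton, htA.2, htB.2] at h1
  have hmem : A ∪ B ∈ N := hN.maximal _ ⟨hne, by linarith⟩
    fun R hR => not_crosses_union_children hN hS hA hB hR
  have hAsub : A ⊂ A ∪ B := by
    refine subset_union_left.ssubset_of_ne fun h => ?_
    obtain ⟨v, hv⟩ := htB.1
    exact Finset.disjoint_left.1 hdisj (h ▸ mem_union_right A hv) hv
  have hABS : A ∪ B = S := by
    by_contra hne'
    exact (mem_children.1 hA).2.2 _ hmem hAsub ((union_subset (ssubset_of_mem_children hA).subset
      (ssubset_of_mem_children hB).subset).ssubset_of_ne hne')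
  have heg : e ≠ g := by rintro rfl; exact (mem_frac.1 he).2.ne hg1
  have hsub : ({e, g} : Finset (Sym2 V)) ⊆ level N S := by simp [insert_subset_iff, heS, hgS]
  have h2 := hy.sum_inside_add_le hdisj
    (show {e, g} ⊆ inside (A ∪ B) by rw [hABS]; exact hsub.trans (filter_subset _ _))
    (hlev _ hsub A hA) (hlev _ hsub B hB)
  rw [sum_pair heg, htA.2, htB.2] at h2
  linarith [(mem_frac.1 he).1]

theorem inside_sdiff_union {C : Finset V} (hCS : C ⊆ S) :
    inside S = (inside C ∪ inside (S \ C)) ∪ (inside S).filter (· ∈ crossing C) := by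
  ext e
  induction e with | _ a b
  simp only [mem_union, mem_filter, mk_mem_inside, mk_mem_crossing, mem_sdiff]
  have := @hCS a
  have := @hCS b
  tauto

theorem IsForestPoint.one_le_sum_crossing (hy : IsForestPoint y) (hS : IsTight y S)
    {C : Finset V} (hC : C.Nonempty) (hCS : C ⊂ S) :
    1 ≤ ∑ e ∈ (inside S).filter (· ∈ crossing C), y e := by
  have h1 := hS.2
  have hne : (S \ C).Nonempty := sdiff_nonempty.2 hCS.not_subset
  have h2 := hy.sum_inside_le _ hC
  have h3 := hy.sum_inside_le _ hne
  have h4 : (#(S \ C) : ℝ) + #C = #S := by exact_mod_cast card_sdiff_add_card_eq_card hCS.subset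
  rw [inside_sdiff_union hCS.subset, sum_union, sum_union (inside_disjoint disjoint_sdiff)] at h1
  · linarith
  · rw [Finset.disjoint_left]
    intro e
    induction e with | _ a b
    simp only [mem_union, mem_filter, mk_mem_inside, mk_mem_crossing, mem_sdiff]
    tauto

theorem two_le_card_crossing (hy : IsForestPoint y) (hN : IsTightFamily y N) (hS : S ∈ N)
    (hl : (frac y ∩ level N S).Nonempty) {C : Finset V} (hC : C ∈ children N S) :
    2 ≤ #((frac y ∩ level N S).filter (· ∈ crossing C)) := by
  obtain ⟨e, he⟩ := hl
  rw [mem_inter] at he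
  set K := (frac y ∩ level N S).filter (· ∈ crossing C)
  have h1 := hy.one_le_sum_crossing (hN.tight S hS) (hN.tight C (children_subset hC)).1
    (ssubset_of_mem_children hC)
  have h2 : ∑ e ∈ (inside S).filter (· ∈ crossing C), y e ≤ ∑ e ∈ K, y e := by
    rw [← sum_filter_ne_zero]
    refine sum_le_sum_of_subset_of_nonneg (fun g hg => ?_) fun g _ _ => hy.nonneg g
    obtain ⟨hg, hg0⟩ := mem_filter.1 hg
    rw [mem_filter] at hg
    have hpos := (hy.nonneg g).lt_of_ne' hg0
    have hgl := crossing_child_mem_level hN.laminar hC hg.2 hg.1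
    exact mem_filter.2 ⟨mem_inter.2 ⟨mem_frac_of_mem_level hy hN hS he.1 he.2 hpos hgl, hgl⟩, hg.2⟩
  by_contra hlt
  have hK : #K ≤ 1 := by omega
  rcases Nat.le_one_iff_eq_zero_or_eq_one.1 hK with h | h
  · rw [card_eq_zero] at h
    rw [h, sum_empty] at h2
    linarith
  · obtain ⟨g, h⟩ := card_eq_one.1 h
    have hgK : g ∈ K := by simp [h]
    have := (mem_frac.1 (mem_inter.1 (mem_filter.1 hgK).1).1).2
    rw [h, sum_singleton] at h2
    linarith

theorem level_subset_crossing (hs : ∀ v : V, {v} ∈ N) (hS : 2 ≤ #S)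
    (h2 : #(children N S) = 2) {C : Finset V} (hC : C ∈ children N S) {e : Sym2 V}
    (he : e ∈ level N S) : e ∈ crossing C := by
  rw [level, mem_filter] at he
  obtain ⟨heS, hel⟩ := he
  obtain ⟨D, hD⟩ : ∃ D, (children N S).erase C = {D} := by
    rw [← card_eq_one, card_erase_of_mem hC, h2]
  have hcov : ∀ v ∈ S, v ∉ C → v ∈ D := by
    intro v hv hvC
    obtain ⟨B, hB, hvB⟩ := exists_mem_child hs hS hv
    have : B ∈ (children N S).erase C := mem_erase.2 ⟨by rintro rfl; exact hvC hvB, hB⟩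
    rw [hD, mem_singleton] at this
    exact this ▸ hvB
  have hDm : D ∈ children N S := mem_of_mem_erase (hD ▸ mem_singleton_self D)
  have h1 := hel C hC
  have h3 := hel D hDm
  induction e with | _ a b
  simp only [mk_mem_inside, mk_mem_crossing] at *
  grind

end Levels

/-- The members of `N` whose level contains a fractional pair. -/
def activeLevels [Fintype V] (y : Sym2 V → ℝ) (N : Finset (Finset V)) : Finset (Finset V) :=
  N.filter fun R => (frac y ∩ level N R).Nonempty

/-- The indicator vector of the fractional pairs in the level of `S`. -/
def levelVec [Fintype V] (y : Sym2 V → ℝ) (N : Finset (Finset V)) (S : Finset V) (e : Sym2 V) : ℤ :=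
  if e ∈ frac y ∩ level N S then 1 else 0

/-- The number of endpoints in `S` of every fractional pair. -/
def multVec [Fintype V] (y : Sym2 V → ℝ) (S : Finset V) (e : Sym2 V) : ℤ :=
  if e ∈ frac y then mult S e else 0

/-- The lattice spanned by the vectors of the active levels and the members of `D`. -/
def constraintLattice [Fintype V] (y : Sym2 V → ℝ) (N D : Finset (Finset V)) :
    AddSubgroup (Sym2 V → ℤ) :=
  AddSubgroup.closure (levelVec y N '' (activeLevels y N : Set (Finset V)) ∪
    multVec y '' (D : Set (Finset V)))

/-- The number of fractional half-pairs in `S`, minus twice the number of active levels inside `S`,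
minus twice the number of members of `D`. -/
def surplus [Fintype V] (y : Sym2 V → ℝ) (N D : Finset (Finset V)) (S : Finset V) : ℤ :=
  ∑ e, multVec y S e - 2 * #((activeLevels y N).filter (· ⊆ S)) - 2 * #D

/-- The invariant of the counting argument: `S` contains no constraints, or its surplus is large, or
its vector is an integral combination of constraints up to a small nonnegative error. -/
def SurplusBound [Fintype V] (y : Sym2 V → ℝ) (N D : Finset (Finset V)) (S : Finset V) : Prop :=
  ((activeLevels y N).filter (· ⊆ S) = ∅ ∧ D = ∅) ∨ 4 ≤ surplus y N D S ∨
    ∃ m : Sym2 V → ℤ, (∀ e, 0 ≤ m e) ∧ (∀ e ∉ frac y, m e = 0) ∧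
      ∑ e, m e + 2 ≤ surplus y N D S ∧ multVec y S - m ∈ constraintLattice y N D

section Counting

variable [Fintype V] {y : Sym2 V → ℝ} {N D : Finset (Finset V)} {S : Finset V}

theorem multVec_nonneg (S : Finset V) (e : Sym2 V) : 0 ≤ multVec y S e := by
  unfold multVec; split_ifs <;> simp [mult_nonneg]

theorem multVec_eq_zero {e : Sym2 V} (he : e ∉ frac y) : multVec y S e = 0 := if_neg he

theorem constraintLattice_mono {D' : Finset (Finset V)} (h : D ⊆ D') :
    constraintLattice y N D ≤ constraintLattice y N D' :=
  AddSubgroup.closure_mono (Set.union_subset_union_right _ (Set.image_mono (coe_subset.2 h)))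

theorem levelVec_mem (hS : S ∈ activeLevels y N) : levelVec y N S ∈ constraintLattice y N D :=
  AddSubgroup.subset_closure (Or.inl ⟨S, hS, rfl⟩)

theorem multVec_mem (hS : S ∈ D) : multVec y S ∈ constraintLattice y N D :=
  AddSubgroup.subset_closure (Or.inr ⟨S, hS, rfl⟩)

theorem surplus_of_empty (h : (activeLevels y N).filter (· ⊆ S) = ∅ ∧ D = ∅) :
    surplus y N D S = ∑ e, multVec y S e := by
  simp [surplus, h.1, h.2]

theorem SurplusBound.nonneg (h : SurplusBound y N D S) : 0 ≤ surplus y N D S := by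
  rcases h with h | h | ⟨m, hm, -, h, -⟩
  · rw [surplus_of_empty h]
    exact sum_nonneg fun e _ => multVec_nonneg S e
  · omega
  · have := sum_nonneg fun e (_ : e ∈ univ) => hm e
    omega

theorem SurplusBound.two_le (h : SurplusBound y N D S) (h2 : 2 ≤ ∑ e, multVec y S e) :
    2 ≤ surplus y N D S := by
  rcases h with h | h | ⟨m, hm, -, h, -⟩
  · rwa [surplus_of_empty h]
  · omega
  · have := sum_nonneg fun e (_ : e ∈ univ) => hm e
    omega

theorem multVec_children (hN : IsTightFamily y N) (hS : 2 ≤ #S) :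
    multVec y S = ∑ C ∈ children N S, multVec y C := by
  ext e
  rw [Finset.sum_apply]
  by_cases he : e ∈ frac y
  · simp only [multVec, if_pos he]
    exact mult_children hN.laminar hN.singleton_mem hS e
  · simp [multVec, he]

theorem surplus_children (hN : IsTightFamily y N) (hS : 2 ≤ #S) (hD : D ⊆ N) :
    surplus y N (D.filter (· ⊂ S)) S =
      ∑ C ∈ children N S, surplus y N (D.filter (· ⊆ C)) C -
        2 * if S ∈ activeLevels y N then 1 else 0 := by
  have hne : ∀ A ∈ N, A.Nonempty := fun A hA => (hN.tight A hA).1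
  have hact : activeLevels y N ⊆ N := filter_subset _ _
  have h1 : (#((activeLevels y N).filter (· ⊆ S)) : ℤ) =
      #((activeLevels y N).filter (· ⊂ S)) + if S ∈ activeLevels y N then 1 else 0 := by
    have : (activeLevels y N).filter (· ⊆ S) =
        (activeLevels y N).filter (· ⊂ S) ∪ (activeLevels y N).filter (· = S) := by
      ext R
      simp only [mem_filter, mem_union, subset_iff_ssubset_or_eq]
      tauto
    rw [this, card_union_of_disjoint, filter_eq']
    · split_ifs <;> simp
    · rw [Finset.disjoint_left]
      simp only [mem_filter]
      rintro R ⟨-, h⟩ ⟨-, rfl⟩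
      exact h.ne rfl
  simp only [surplus, h1, card_descendants hN.laminar hne hact,
    card_descendants hN.laminar hne hD, multVec_children hN hS, Finset.sum_apply, sum_sub_distrib,
    ← mul_sum]
  rw [sum_comm]
  push_cast
  ring

theorem four_le_sum {ι : Type*} {s : Finset ι} {f : ι → ℤ} {k : ℤ} (hf : ∀ i ∈ s, k ≤ f i)
    {i : ι} (hi : i ∈ s) (h4 : 4 ≤ f i) : 4 + k * (#s - 1 : ℤ) ≤ ∑ i ∈ s, f i := by
  rw [← add_sum_erase s f hi]
  have := card_nsmul_le_sum (s.erase i) f k fun j hj => hf j (mem_of_mem_erase hj)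
  rw [card_erase_of_mem hi, nsmul_eq_mul, Nat.cast_sub (card_pos.2 ⟨i, hi⟩)] at this
  push_cast at this
  linarith

theorem le_sum_multVec (hy : IsForestPoint y) {K : Finset (Sym2 V)} (hK : K ⊆ frac y)
    (hKS : K ⊆ crossing S) : (#K : ℤ) ≤ ∑ e, multVec y S e := by
  calc (#K : ℤ) = ∑ e ∈ K, 1 := by simp
    _ ≤ ∑ e ∈ K, multVec y S e := by
      refine sum_le_sum fun e he => ?_
      have hf := hK he
      rw [multVec, if_pos hf, mult_eq (hy.not_isDiag (mem_frac.1 hf).1), if_pos (hKS he)]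
      split_ifs <;> simp
    _ ≤ _ := sum_le_sum_of_subset_of_nonneg (subset_univ _) fun e _ _ => multVec_nonneg S e

theorem constraintLattice_child {C : Finset V} (hC : C ∈ children N S) :
    constraintLattice y N (D.filter (· ⊆ C)) ≤ constraintLattice y N (D.filter (· ⊂ S)) :=
  constraintLattice_mono fun _ hR => mem_filter.2 ⟨(mem_filter.1 hR).1,
    (mem_filter.1 hR).2.trans_ssubset (ssubset_of_mem_children hC)⟩

theorem filter_activeLevels_eq_empty (hS : S ∉ activeLevels y N)
    (h : ∀ C ∈ children N S, (activeLevels y N).filter (· ⊆ C) = ∅) :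
    (activeLevels y N).filter (· ⊆ S) = ∅ := by
  refine filter_eq_empty_iff.2 fun R hR hRS => ?_
  rcases eq_or_ne R S with rfl | hne
  · exact hS hR
  · obtain ⟨C, hC, hRC⟩ := exists_child (filter_subset _ _ hR) (hRS.ssubset_of_ne hne)
    exact filter_eq_empty_iff.1 (h C hC) hR hRC

theorem surplusBound_of_inactive (hN : IsTightFamily y N) (hD : D ⊆ N) (hS : 2 ≤ #S)
    (hact : S ∉ activeLevels y N)
    (ih : ∀ C ∈ children N S, SurplusBound y N (D.filter (· ⊆ C)) C) :
    SurplusBound y N (D.filter (· ⊂ S)) S := by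
  have hsur := surplus_children hN hS hD
  rw [if_neg hact, mul_zero, sub_zero] at hsur
  by_cases h4 : ∃ C ∈ children N S, 4 ≤ surplus y N (D.filter (· ⊆ C)) C
  · obtain ⟨C, hC, h4⟩ := h4
    have := four_le_sum (fun C hC => (ih C hC).nonneg) hC h4
    exact Or.inr (Or.inl (by linarith))
  push Not at h4
  by_cases hall : ∀ C ∈ children N S,
      (activeLevels y N).filter (· ⊆ C) = ∅ ∧ D.filter (· ⊆ C) = ∅
  · exact Or.inl ⟨filter_activeLevels_eq_empty hact fun C hC => (hall C hC).1,
      filter_ssubset_eq_empty hD fun C hC => (hall C hC).2⟩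
  push Not at hall
  obtain ⟨C₀, hC₀, hne⟩ := hall
  have hm : ∀ C, ∃ m : Sym2 V → ℤ, C ∈ children N S → (∀ e, 0 ≤ m e) ∧ (∀ e ∉ frac y, m e = 0) ∧
      ∑ e, m e + (if C = C₀ then 2 else 0) ≤ surplus y N (D.filter (· ⊆ C)) C ∧
      multVec y C - m ∈ constraintLattice y N (D.filter (· ⊂ S)) := by
    intro C
    by_cases hC : C ∈ children N S
    · rcases ih C hC with h | h | ⟨m, h0, h1, h2, h3⟩
      · refine ⟨multVec y C, fun _ => ⟨multVec_nonneg C, fun e => multVec_eq_zero, ?_, ?_⟩⟩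
        · rw [surplus_of_empty h, if_neg (by rintro rfl; exact (hne h.1).ne_empty h.2), add_zero]
        · rw [sub_self]; exact zero_mem _
      · exact absurd h (h4 C hC).not_ge
      · refine ⟨m, fun _ => ⟨h0, h1, ?_, constraintLattice_child hC h3⟩⟩
        split_ifs <;> omega
    · exact ⟨0, fun h => absurd h hC⟩
  choose m hm using hm
  refine Or.inr (Or.inr ⟨∑ C ∈ children N S, m C, fun e => ?_, fun e he => ?_, ?_, ?_⟩)
  · rw [Finset.sum_apply]; exact sum_nonneg fun C hC => (hm C hC).1 e
  · rw [Finset.sum_apply]; exact sum_eq_zero fun C hC => (hm C hC).2.1 e he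
  · have := sum_le_sum fun C hC => (hm C hC).2.2.1
    rw [sum_add_distrib, sum_ite_eq', if_pos hC₀] at this
    simp only [Finset.sum_apply]
    rw [sum_comm, hsur]
    exact this
  · rw [multVec_children hN hS, ← sum_sub_distrib]
    exact sum_mem fun C hC => (hm C hC).2.2.2

theorem surplusBound_of_active (hy : IsForestPoint y) (hN : IsTightFamily y N) (hD : D ⊆ N)
    (hSN : S ∈ N) (hS : 2 ≤ #S) (hact : S ∈ activeLevels y N)
    (ih : ∀ C ∈ children N S, SurplusBound y N (D.filter (· ⊆ C)) C) :
    SurplusBound y N (D.filter (· ⊂ S)) S := by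
  have hsur := surplus_children hN hS hD
  rw [if_pos hact, mul_one] at hsur
  have hcard := two_le_card_children hN.singleton_mem hS
  have hlev := fun C hC => two_le_card_crossing hy hN hSN (mem_filter.1 hact).2 (C := C) hC
  have h2 : ∀ C ∈ children N S, 2 ≤ surplus y N (D.filter (· ⊆ C)) C := by
    intro C hC
    refine (ih C hC).two_le (le_trans (by exact_mod_cast hlev C hC) (le_sum_multVec hy
      (K := (frac y ∩ level N S).filter (· ∈ crossing C)) ?_ ?_))
    · exact (filter_subset _ _).trans inter_subset_left
    · exact fun e he => (mem_filter.1 he).2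
  by_cases h4 : ∃ C ∈ children N S, 4 ≤ surplus y N (D.filter (· ⊆ C)) C
  · obtain ⟨C, hC, h4⟩ := h4
    have := four_le_sum h2 hC h4
    exact Or.inr (Or.inl (by omega))
  push Not at h4
  by_cases h3 : 3 ≤ #(children N S)
  · have := card_nsmul_le_sum _ _ _ h2
    rw [nsmul_eq_mul] at this
    exact Or.inr (Or.inl (by omega))
  have hc2 : #(children N S) = 2 := by omega
  have hcross : ∀ C ∈ children N S, ∀ e ∈ frac y ∩ level N S, e ∈ crossing C := fun C hC e he =>
    level_subset_crossing hN.singleton_mem hS hc2 hC (mem_inter.1 he).2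
  have hm : ∀ C, ∃ m : Sym2 V → ℤ, C ∈ children N S → (∀ e, 0 ≤ m e) ∧ (∀ e ∉ frac y, m e = 0) ∧
      ∑ e, m e + 2 ≤ surplus y N (D.filter (· ⊆ C)) C ∧
      multVec y C - m ∈ constraintLattice y N (D.filter (· ⊂ S)) := by
    intro C
    by_cases hC : C ∈ children N S
    · rcases ih C hC with h | h | ⟨m, h0, h1, h2, h3⟩
      · refine ⟨multVec y C - levelVec y N S, fun _ => ⟨fun e => ?_, fun e he => ?_, ?_, ?_⟩⟩
        · rw [Pi.sub_apply, levelVec]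
          split_ifs with he
          · have hf := (mem_inter.1 he).1
            rw [multVec, if_pos hf, mult_eq (hy.not_isDiag (mem_frac.1 hf).1),
              if_pos (hcross C hC e he)]
            split_ifs <;> simp
          · simpa using multVec_nonneg C e
        · have : e ∉ frac y ∩ level N S := fun h => he (mem_inter.1 h).1
          rw [Pi.sub_apply, multVec_eq_zero he, levelVec, if_neg this, sub_zero]
        · have hl : ∑ e, levelVec y N S e = #(frac y ∩ level N S) := by
            simp only [levelVec]
            rw [sum_boole, filter_mem_eq_inter, univ_inter]
          have := hlev C hC
          rw [filter_true_of_mem (hcross C hC)] at this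
          simp only [Pi.sub_apply, sum_sub_distrib]
          rw [surplus_of_empty h, hl]
          omega
        · rw [sub_sub_cancel]; exact levelVec_mem hact
      · exact absurd h (h4 C hC).not_ge
      · exact ⟨m, fun _ => ⟨h0, h1, h2, constraintLattice_child hC h3⟩⟩
    · exact ⟨0, fun h => absurd h hC⟩
  choose m hm using hm
  refine Or.inr (Or.inr ⟨∑ C ∈ children N S, m C, fun e => ?_, fun e he => ?_, ?_, ?_⟩)
  · rw [Finset.sum_apply]; exact sum_nonneg fun C hC => (hm C hC).1 e
  · rw [Finset.sum_apply]; exact sum_eq_zero fun C hC => (hm C hC).2.1 e he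
  · have := sum_le_sum fun C hC => (hm C hC).2.2.1
    rw [sum_add_distrib, sum_const, hc2] at this
    simp only [Finset.sum_apply]
    rw [sum_comm, hsur]
    simp only [nsmul_eq_mul] at this
    omega
  · rw [multVec_children hN hS, ← sum_sub_distrib]
    exact sum_mem fun C hC => (hm C hC).2.2.2

theorem surplusBound_ssubset (hy : IsForestPoint y) (hN : IsTightFamily y N) (hD : D ⊆ N)
    (hS : S ∈ N) (ih : ∀ C ∈ children N S, SurplusBound y N (D.filter (· ⊆ C)) C) :
    SurplusBound y N (D.filter (· ⊂ S)) S := by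
  by_cases h2 : 2 ≤ #S
  · by_cases hact : S ∈ activeLevels y N
    · exact surplusBound_of_active hy hN hD hS h2 hact ih
    · exact surplusBound_of_inactive hN hD h2 hact ih
  · have hempty : ∀ C, C ∉ children N S := by
      intro C hC
      have h := card_lt_card (ssubset_of_mem_children hC)
      have := card_pos.2 (hN.tight C (children_subset hC)).1
      omega
    refine Or.inl ⟨filter_activeLevels_eq_empty (fun hact => ?_) fun C hC => absurd hC (hempty C),
      filter_ssubset_eq_empty hD fun C hC => absurd hC (hempty C)⟩
    obtain ⟨e, he⟩ := (mem_filter.1 hact).2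
    rw [mem_inter] at he
    exact h2 (two_le_card_of_mem_inside (hy.not_isDiag (mem_frac.1 he.1).1)
      (mem_filter.1 he.2).1)

end Counting

section Integrality

variable [Fintype V] {y : Sym2 V → ℝ} {N D : Finset (Finset V)} {S : Finset V}

theorem sum_mul_mult {d : Sym2 V → ℝ} (hd : ∀ e, e.IsDiag → d e = 0) (S : Finset V) :
    ∑ e, d e * mult S e = ∑ e ∈ crossing S, d e + 2 * ∑ e ∈ inside S, d e := by
  rw [sum_inside_eq, ← Finset.univ_inter (crossing S), ← Finset.sum_ite_mem, mul_sum,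
    ← sum_add_distrib]
  refine sum_congr rfl fun e _ => ?_
  by_cases he : e.IsDiag
  · simp [hd e he]
  · rw [mult_eq he]
    split_ifs <;> push_cast <;> ring

theorem IsForestPoint.eq_zero_or_one (hy : IsForestPoint y) {e : Sym2 V} (he : e ∉ frac y) :
    y e = 0 ∨ y e = 1 := by
  rw [mem_frac, not_and_or, not_lt, not_lt] at he
  exact he.imp (fun h => le_antisymm h (hy.nonneg e)) fun h => le_antisymm (hy.le_one e) h

theorem sum_mul_multVec_mem_range (hy : IsForestPoint y) (hS : IsTight y S)
    (hc : ∑ e ∈ crossing S, y e ∈ (Int.castAddHom ℝ).range) :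
    ∑ e, y e * multVec y S e ∈ (Int.castAddHom ℝ).range := by
  have h : ∑ e, y e * multVec y S e =
      ∑ e ∈ crossing S, y e + ((2 * (#S - 1) : ℤ) : ℝ) -
        ∑ e, y e * (if e ∈ frac y then 0 else mult S e : ℤ) := by
    have := sum_mul_mult hy.diag S
    rw [hS.2] at this
    push_cast
    rw [← this, ← sum_sub_distrib]
    refine sum_congr rfl fun e _ => ?_
    unfold multVec
    split_ifs <;> simp
  rw [h]
  refine sub_mem (add_mem hc ⟨_, rfl⟩) (sum_mem fun e _ => ?_)
  split_ifs with he
  · simp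
  · rcases hy.eq_zero_or_one he with h | h
    · simp [h]
    · exact ⟨mult S e, by simp [h]⟩

theorem sum_mul_levelVec (hy : IsForestPoint y) (hN : IsTightFamily y N)
    (hS : S ∈ activeLevels y N) :
    ∑ e, y e * levelVec y N S e = ∑ e ∈ level N S, y e := by
  obtain ⟨hSN, g, hg⟩ := mem_filter.1 hS
  rw [mem_inter] at hg
  rw [← Finset.univ_inter (level N S), ← Finset.sum_ite_mem]
  refine sum_congr rfl fun e _ => ?_
  by_cases he : e ∈ level N S
  · rcases (hy.nonneg e).eq_or_lt with h | h
    · simp [← h]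
    · have := mem_frac_of_mem_level hy hN hSN hg.1 hg.2 h he
      simp [levelVec, he, this]
  · simp [levelVec, he]

theorem sum_mul_levelVec_mem_range (hy : IsForestPoint y) (hN : IsTightFamily y N)
    (hS : S ∈ activeLevels y N) :
    ∑ e, y e * levelVec y N S e ∈ (Int.castAddHom ℝ).range := by
  have hcard : ∀ R ∈ N, ∑ e ∈ inside R, y e ∈ (Int.castAddHom ℝ).range := fun R hR =>
    ⟨#R - 1, by rw [(hN.tight R hR).2]; simp⟩
  rw [sum_mul_levelVec hy hN hS, eq_sub_of_add_eq (sum_inside hN.laminar y).symm]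
  exact sub_mem (hcard S (mem_filter.1 hS).1)
    (sum_mem fun C hC => hcard C (children_subset hC))

theorem sum_mul_mem_range (hy : IsForestPoint y) (hN : IsTightFamily y N) (hD : D ⊆ N)
    (hc : ∀ A ∈ D, ∑ e ∈ crossing A, y e ∈ (Int.castAddHom ℝ).range)
    {f : Sym2 V → ℤ} (hf : f ∈ constraintLattice y N D) :
    ∑ e, y e * f e ∈ (Int.castAddHom ℝ).range := by
  induction hf using AddSubgroup.closure_induction with
  | mem f hf =>
    rcases hf with ⟨R, hR, rfl⟩ | ⟨A, hA, rfl⟩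
    · exact sum_mul_levelVec_mem_range hy hN hR
    · exact sum_mul_multVec_mem_range hy (hN.tight A (hD hA)) (hc A hA)
  | zero => simp
  | add f g _ _ hf hg =>
    simp only [Pi.add_apply, Int.cast_add, mul_add, sum_add_distrib]
    exact add_mem hf hg
  | neg f _ hf =>
    simp only [Pi.neg_apply, Int.cast_neg, mul_neg, sum_neg_distrib]
    exact neg_mem hf

end Integrality

section Independence

variable [Fintype V] {y : Sym2 V → ℝ} {N D : Finset (Finset V)} {S : Finset V}

theorem eq_zero_of_sum_le_one {m : Sym2 V → ℤ} (h0 : ∀ e, 0 ≤ m e)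
    (hm : ∀ e ∉ frac y, m e = 0) (h1 : ∑ e, m e ≤ 1)
    (hr : ∑ e, y e * m e ∈ (Int.castAddHom ℝ).range) : m = 0 := by
  by_contra hne
  obtain ⟨g, hg⟩ : ∃ g, m g ≠ 0 := by
    by_contra! h; exact hne (funext h)
  have hgf : g ∈ frac y := by by_contra h; exact hg (hm g h)
  have hgpos : 0 < m g := lt_of_le_of_ne (h0 g) hg.symm
  have hle : ∀ e, 0 ≤ y e * m e ∧ y e * m e ≤ m e := by
    intro e
    by_cases he : e ∈ frac y
    · have := mem_frac.1 he
      have h : (0 : ℝ) ≤ m e := by exact_mod_cast h0 e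
      constructor <;> nlinarith
    · simp [hm e he]
  have hgpos' : (0 : ℝ) < m g := by exact_mod_cast hgpos
  have hfg := mem_frac.1 hgf
  obtain ⟨k, hk⟩ := hr
  have hlo : 0 < ∑ e, y e * m e :=
    sum_pos' (fun e _ => (hle e).1) ⟨g, mem_univ g, mul_pos hfg.1 hgpos'⟩
  have hhi : ∑ e, y e * m e < ∑ e, (m e : ℝ) :=
    sum_lt_sum (fun e _ => (hle e).2) ⟨g, mem_univ g, by nlinarith⟩
  have h1' : ∑ e, (m e : ℝ) ≤ 1 := by exact_mod_cast h1
  rw [← hk] at hlo hhi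
  have h2 : (0 : ℝ) < k := hlo
  have h3 : (k : ℝ) < 1 := hhi.trans_le h1'
  norm_cast at h2 h3
  omega

theorem surplusBound_subset (hy : IsForestPoint y) (hN : IsTightFamily y N) (hD : D ⊆ N)
    (hc : ∀ A ∈ D, ∑ e ∈ crossing A, y e ∈ (Int.castAddHom ℝ).range)
    (h4 : ∀ A ∈ D, 4 ≤ #(frac y ∩ crossing A))
    (hind : ∀ A ∈ D, multVec y A ∉ constraintLattice y N (D.filter (· ⊂ A)))
    (h : SurplusBound y N (D.filter (· ⊂ S)) S) :
    SurplusBound y N (D.filter (· ⊆ S)) S := by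
  have hsplit : D.filter (· ⊆ S) = D.filter (· ⊂ S) ∪ D.filter (· = S) := by
    ext R
    simp only [mem_filter, mem_union, subset_iff_ssubset_or_eq]
    tauto
  by_cases hS : S ∈ D
  · have hcard : #(D.filter (· ⊆ S)) = #(D.filter (· ⊂ S)) + 1 := by
      rw [hsplit, card_union_of_disjoint, filter_eq', if_pos hS, card_singleton]
      rw [Finset.disjoint_left]
      simp only [mem_filter]
      rintro R ⟨-, h⟩ ⟨-, rfl⟩
      exact h.ne rfl
    have hsur : surplus y N (D.filter (· ⊆ S)) S = surplus y N (D.filter (· ⊂ S)) S - 2 := by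
      simp only [surplus, hcard]
      push_cast
      ring
    have h4' : 4 ≤ surplus y N (D.filter (· ⊂ S)) S := by
      rcases h with h | h | ⟨m, h0, h1, h2, h3⟩
      · rw [surplus_of_empty h]
        exact le_trans (by exact_mod_cast h4 S hS)
          (le_sum_multVec hy inter_subset_left inter_subset_right)
      · exact h
      · by_contra hlt
        have hm : m = 0 := by
          refine eq_zero_of_sum_le_one h0 h1 (by omega) ?_
          have hr := sum_mul_mem_range hy hN ((filter_subset _ _).trans hD)
            (fun A hA => hc A (mem_filter.1 hA).1) h3
          have hr' := sum_mul_multVec_mem_range hy (hN.tight S (hD hS)) (hc S hS)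
          have := sub_mem hr' hr
          simpa [← sum_sub_distrib, mul_sub] using this
        rw [hm, sub_zero] at h3
        exact hind S hS h3
    refine Or.inr (Or.inr ⟨0, fun _ => le_rfl, fun _ _ => rfl, ?_, ?_⟩)
    · rw [hsur]
      simp
      omega
    · rw [sub_zero]
      exact multVec_mem (mem_filter.2 ⟨hS, subset_rfl⟩)
  · rwa [hsplit, filter_eq', if_neg hS, union_empty]

/-- Independent constraints are fewer than fractional pairs. -/
theorem card_constraints_lt (hy : IsForestPoint y) (hN : IsTightFamily y N) (hu : IsTight y univ)
    (hne : (frac y).Nonempty) (hD : D ⊆ N)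
    (hc : ∀ A ∈ D, ∑ e ∈ crossing A, y e ∈ (Int.castAddHom ℝ).range)
    (h4 : ∀ A ∈ D, 4 ≤ #(frac y ∩ crossing A))
    (hind : ∀ A ∈ D, multVec y A ∉ constraintLattice y N (D.filter (· ⊂ A))) :
    #(activeLevels y N) + #D < #(frac y) := by
  have key : ∀ S ∈ N, SurplusBound y N (D.filter (· ⊆ S)) S := by
    intro S
    induction S using Finset.strongInduction with
    | H S ih =>
      intro hS
      exact surplusBound_subset hy hN hD hc h4 hind (surplusBound_ssubset hy hN hD hS
        fun C hC => ih C (ssubset_of_mem_children hC) (children_subset hC))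
  have hsum : ∑ e, multVec y univ e = 2 * #(frac y) := by
    have : ∀ e, multVec y univ e = if e ∈ frac y then 2 else 0 := by
      intro e
      unfold multVec
      split_ifs with he
      · have hd := hy.not_isDiag (mem_frac.1 he).1
        induction e with | _ a b
        rw [mult_mk (by simpa using hd)]
        simp
      · rfl
    simp only [this]
    simp
    ring
  have hpos := card_pos.2 hne
  have := (key univ (hN.univ_mem hu)).two_le (by omega)
  simp only [surplus, subset_univ, filter_true, hsum] at this
  omega

end Independence

section Direction

variable [Fintype V] {y : Sym2 V → ℝ} {N D : Finset (Finset V)}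

theorem sum_mul_eq_zero_of_mem {d : Sym2 V → ℝ}
    (hl : ∀ R ∈ activeLevels y N, ∑ e, d e * levelVec y N R e = 0)
    (hm : ∀ A ∈ D, ∑ e, d e * multVec y A e = 0)
    {f : Sym2 V → ℤ} (hf : f ∈ constraintLattice y N D) : ∑ e, d e * f e = 0 := by
  induction hf using AddSubgroup.closure_induction with
  | mem f hf =>
    rcases hf with ⟨R, hR, rfl⟩ | ⟨A, hA, rfl⟩
    · exact hl R hR
    · exact hm A hA
  | zero => simp
  | add f g _ _ hf hg => simp [mul_add, sum_add_distrib, hf, hg]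
  | neg f _ hf => simp [hf]

theorem exists_independent (y : Sym2 V → ℝ) (N K : Finset (Finset V)) :
    ∃ D ⊆ K, (∀ A ∈ D, multVec y A ∉ constraintLattice y N (D.filter (· ⊂ A))) ∧
      ∀ d : Sym2 V → ℝ, (∀ R ∈ activeLevels y N, ∑ e, d e * levelVec y N R e = 0) →
        (∀ A ∈ D, ∑ e, d e * multVec y A e = 0) → ∀ A ∈ K, ∑ e, d e * multVec y A e = 0 := by
  obtain ⟨D, hDK, hD⟩ := Finite.exists_le_minimal (a := K) (p := fun D : Finset (Finset V) =>
    ∀ d : Sym2 V → ℝ, (∀ R ∈ activeLevels y N, ∑ e, d e * levelVec y N R e = 0) →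
      (∀ A ∈ D, ∑ e, d e * multVec y A e = 0) → ∀ A ∈ K, ∑ e, d e * multVec y A e = 0)
    fun d _ h => h
  refine ⟨D, hDK, fun A hA hmem => ?_, hD.prop⟩
  have hsub : D.filter (· ⊂ A) ⊆ D.erase A := fun R hR => by
    rw [mem_filter] at hR
    exact mem_erase.2 ⟨hR.2.ne, hR.1⟩
  refine (hD.le_of_le (y := D.erase A) (fun d hl hm => hD.prop d hl fun B hB => ?_)
    (erase_subset A D)).not_gt (erase_ssubset hA)
  rcases eq_or_ne B A with rfl | hBA
  · exact sum_mul_eq_zero_of_mem hl hm (constraintLattice_mono hsub hmem)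
  · exact hm B (mem_erase.2 ⟨hBA, hB⟩)

theorem exists_orthogonal {α ι : Type*} [Fintype α] [Fintype ι] (F : Finset α) (v : ι → α → ℝ)
    (h : Fintype.card ι < #F) :
    ∃ d : α → ℝ, d ≠ 0 ∧ (∀ a ∉ F, d a = 0) ∧ ∀ i, ∑ a, d a * v i a = 0 := by
  obtain ⟨d, hd, hne⟩ := (Submodule.ne_bot_iff _).1 (LinearMap.ker_ne_bot_of_finrank_lt
    (f := Matrix.mulVecLin (Matrix.of fun (i : ι) (a : F) => v i a)) (by simpa using h))
  refine ⟨fun a => if h : a ∈ F then d ⟨a, h⟩ else 0, fun h0 => hne ?_, fun a ha => dif_neg ha,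
    fun i => ?_⟩
  · ext a
    simpa using congrFun h0 a
  · have := congrFun (LinearMap.mem_ker.1 hd) i
    simp only [Matrix.mulVecLin_apply, Matrix.mulVec, dotProduct, Matrix.of_apply,
      Pi.zero_apply] at this
    refine Eq.trans ?_ this
    rw [← sum_subset (subset_univ F) fun a _ ha => by simp [ha], ← sum_coe_sort F]
    exact sum_congr rfl fun a _ => by simp [mul_comm]

theorem sum_inside_eq_zero_of_levels (hN : IsTightFamily y N) {d : Sym2 V → ℝ}
    (hd : ∀ e ∉ frac y, d e = 0)
    (hl : ∀ R ∈ activeLevels y N, ∑ e, d e * levelVec y N R e = 0) :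
    ∀ R ∈ N, ∑ e ∈ inside R, d e = 0 := by
  intro R
  induction R using Finset.strongInduction with
  | H R ih =>
    intro hR
    rw [sum_inside hN.laminar, sum_eq_zero (s := children N R) fun C hC =>
      ih C (ssubset_of_mem_children hC) (children_subset hC), add_zero]
    by_cases hact : R ∈ activeLevels y N
    · rw [← hl R hact, ← Finset.univ_inter (level N R), ← Finset.sum_ite_mem]
      refine sum_congr rfl fun e _ => ?_
      by_cases he : e ∈ frac y
      · simp [levelVec, he]
      · simp [hd e he]
    · refine sum_eq_zero fun e he => hd e fun hf => hact ?_
      exact mem_filter.2 ⟨hR, e, mem_inter.2 ⟨hf, he⟩⟩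

/-- At a fractional point some direction preserves all tight subtour constraints and all tight
degree constraints that carry at least four fractional pairs. -/
theorem exists_direction (hy : IsForestPoint y) (hu : IsTight y univ) (hne : (frac y).Nonempty)
    {M K : Finset (Finset V)} (hM : ∀ A ∈ M, ∀ B ∈ M, Disjoint A B ∨ A ⊆ B ∨ B ⊆ A)
    (ht : ∀ A ∈ M, IsTight y A) (hK : K ⊆ M)
    (hc : ∀ A ∈ K, ∑ e ∈ crossing A, y e ∈ (Int.castAddHom ℝ).range)
    (h4 : ∀ A ∈ K, 4 ≤ #(frac y ∩ crossing A)) :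
    ∃ d : Sym2 V → ℝ, d ≠ 0 ∧ (∀ e ∉ frac y, d e = 0) ∧
      (∀ U, IsTight y U → ∑ e ∈ inside U, d e = 0) ∧
      ∀ A ∈ K, ∑ e ∈ crossing A, d e = 0 := by
  obtain ⟨N, hMN, hN⟩ := exists_isTightFamily hy hM ht
  obtain ⟨D, hDK, hind, hspan⟩ := exists_independent y N K
  have hlt := card_constraints_lt hy hN hu hne (hDK.trans (hK.trans hMN))
    (fun A hA => hc A (hDK hA)) (fun A hA => h4 A (hDK hA)) hind
  obtain ⟨d, hd0, hd, horth⟩ := exists_orthogonal (frac y)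
    (Sum.elim (fun (R : activeLevels y N) e => (levelVec y N R e : ℝ))
      fun (A : D) e => (multVec y A e : ℝ)) (by simpa using hlt)
  have hl : ∀ R ∈ activeLevels y N, ∑ e, d e * levelVec y N R e = 0 :=
    fun R hR => horth (Sum.inl ⟨R, hR⟩)
  have hm := hspan d hl fun A hA => horth (Sum.inr ⟨A, hA⟩)
  have hfrac : ∀ e, y e = 0 → d e = 0 := fun e he => hd e fun h => (mem_frac.1 h).1.ne' he
  have hins : ∀ U, IsTight y U → ∑ e ∈ inside U, d e = 0 := fun U hU =>
    hN.sum_inside_eq_zero hy hfrac (sum_inside_eq_zero_of_levels hN hd hl) hU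
  refine ⟨d, hd0, hd, hins, fun A hA => ?_⟩
  have h := sum_mul_mult (fun e he => hfrac e (hy.diag e he)) A
  rw [hins A (ht A (hK hA)), mul_zero, add_zero] at h
  rw [← h, ← hm A hA]
  refine sum_congr rfl fun e _ => ?_
  by_cases he : e ∈ frac y
  · simp [multVec, he]
  · simp [hd e he]

end Direction

/-- Moving along a direction that respects all tight constraints until a new one becomes tight. -/
theorem exists_step {E ι : Type*} [AddCommGroup E] [Module ℝ E] [Fintype ι] (a : ι → E →ₗ[ℝ] ℝ)
    (β : ι → ℝ) {y d : E} (hy : ∀ i, a i y ≤ β i) (hd : ∀ i, a i y = β i → a i d = 0)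
    (hpos : ∃ i, 0 < a i d) :
    ∃ t : ℝ, 0 ≤ t ∧ (∀ i, a i (y + t • d) ≤ β i) ∧
      #(univ.filter fun i => a i (y + t • d) ≠ β i) < #(univ.filter fun i => a i y ≠ β i) := by
  obtain ⟨i₀, hi₀⟩ := hpos
  obtain ⟨j, hj, hmin⟩ := exists_min_image (univ.filter fun i => 0 < a i d)
    (fun i => (β i - a i y) / a i d) ⟨i₀, by simpa using hi₀⟩
  simp only [mem_filter, mem_univ, true_and] at hj hmin
  have ht : 0 ≤ (β j - a j y) / a j d := div_nonneg (sub_nonneg.2 (hy j)) hj.le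
  refine ⟨_, ht, fun i => ?_, card_lt_card ?_⟩
  · rw [map_add, map_smul, smul_eq_mul]
    rcases le_or_gt (a i d) 0 with h | h
    · nlinarith [hy i]
    · have := (le_div_iff₀ h).1 (hmin i h)
      linarith
  · refine (ssubset_iff_of_subset fun i => ?_).2 ⟨j, ?_, ?_⟩
    · simp only [mem_filter, mem_univ, true_and]
      intro h1 h2
      exact h1 (by rw [map_add, map_smul, hd i h2, h2, smul_zero, add_zero])
    · simp only [mem_filter, mem_univ, true_and]
      exact fun h => hj.ne' (hd j h)
    · simp only [mem_filter, mem_univ, true_and, not_not]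
      rw [map_add, map_smul, smul_eq_mul, div_mul_cancel₀ _ hj.ne']
      ring

/-- The points considered by the iterative relaxation: the degree constraints in `K` are still
enforced, those in `M \ K` have been dropped. -/
structure IsFeasible [Fintype V] (F : Finset (Sym2 V)) (M K : Finset (Finset V))
    (b : Finset V → ℤ) (y : Sym2 V → ℝ) : Prop where
  forest : IsForestPoint y
  tight_univ : IsTight y univ
  support : ∀ e ∉ F, y e = 0
  tight : ∀ A ∈ M, IsTight y A
  subset : K ⊆ M
  sum_le : ∀ A ∈ K, ∑ e ∈ crossing A, y e ≤ b A
  card_le : ∀ A ∈ M, A ∉ K → (#((crossing A).filter fun e => 0 < y e) : ℤ) ≤ b A + 2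

section Relaxation

variable [Fintype V] {F : Finset (Sym2 V)} {M K : Finset (Finset V)} {b : Finset V → ℤ}
  {y : Sym2 V → ℝ}

/-- The left-hand sides of the nonnegativity, subtour elimination, and degree constraints. -/
def constraint (K : Finset (Finset V)) :
    Sym2 V ⊕ {U : Finset V // U.Nonempty} ⊕ K → (Sym2 V → ℝ) →ₗ[ℝ] ℝ :=
  Sum.elim (fun e => -LinearMap.proj e) (Sum.elim
    (fun U => ∑ e ∈ inside U.1, LinearMap.proj e) fun A => ∑ e ∈ crossing A.1, LinearMap.proj e)

/-- The right-hand sides of the constraints. -/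
def bound (b : Finset V → ℤ) (K : Finset (Finset V)) :
    Sym2 V ⊕ {U : Finset V // U.Nonempty} ⊕ K → ℝ :=
  Sum.elim (fun _ => 0) (Sum.elim (fun U => #U.1 - 1) fun A => b A)

theorem constraint_inl (e : Sym2 V) : constraint K (Sum.inl e) y = -y e := rfl

theorem constraint_inside (U : {U : Finset V // U.Nonempty}) :
    constraint K (Sum.inr (Sum.inl U)) y = ∑ e ∈ inside U.1, y e := by
  simp [constraint, LinearMap.sum_apply]

theorem constraint_crossing (A : K) :
    constraint K (Sum.inr (Sum.inr A)) y = ∑ e ∈ crossing A.1, y e := by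
  simp [constraint, LinearMap.sum_apply]

theorem IsFeasible.constraint_le (hy : IsFeasible F M K b y) :
    ∀ i, constraint K i y ≤ bound b K i := by
  rintro (e | U | A)
  · rw [constraint_inl]
    exact neg_nonpos.2 (hy.forest.nonneg e)
  · rw [constraint_inside]
    exact hy.forest.sum_inside_le U.1 U.2
  · rw [constraint_crossing]
    exact hy.sum_le A.1 A.2

theorem IsFeasible.add_smul (hy : IsFeasible F M K b y) {d : Sym2 V → ℝ} {t : ℝ}
    (hd : ∀ e ∉ frac y, d e = 0) (hins : ∀ U, IsTight y U → ∑ e ∈ inside U, d e = 0)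
    (hle : ∀ i, constraint K i (y + t • d) ≤ bound b K i) : IsFeasible F M K b (y + t • d) := by
  have hzero : ∀ e, y e = 0 → (y + t • d) e = 0 := fun e he => by
    simp [he, hd e fun h => (mem_frac.1 h).1.ne' he]
  have htight : ∀ U, IsTight y U → IsTight (y + t • d) U := fun U hU => ⟨hU.1, by
    simp [sum_add_distrib, ← mul_sum, hins U hU, hU.2]⟩
  refine ⟨⟨fun e => ?_, fun e he => hzero e (hy.forest.diag e he), fun U hU => ?_⟩,
    htight _ hy.tight_univ, fun e he => hzero e (hy.support e he),
    fun A hA => htight A (hy.tight A hA), hy.subset, fun A hA => ?_, fun A hA hAK => ?_⟩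
  · have := hle (Sum.inl e)
    rw [constraint_inl] at this
    exact neg_nonpos.1 this
  · have := hle (Sum.inr (Sum.inl ⟨U, hU⟩))
    rwa [constraint_inside] at this
  · have := hle (Sum.inr (Sum.inr ⟨A, hA⟩))
    rwa [constraint_crossing] at this
  · refine le_trans ?_ (hy.card_le A hA hAK)
    have : (crossing A).filter (fun e => 0 < (y + t • d) e) ⊆
        (crossing A).filter fun e => 0 < y e := fun e he => by
      rw [mem_filter] at he ⊢
      exact ⟨he.1, lt_of_le_of_ne (hy.forest.nonneg e) fun h => he.2.ne' (hzero e h.symm)⟩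
    exact_mod_cast card_le_card this

theorem exists_constraint_pos {d : Sym2 V → ℝ} (hd0 : d ≠ 0) : ∃ i, 0 < constraint K i d := by
  by_cases hneg : ∃ e, d e < 0
  · obtain ⟨e, he⟩ := hneg
    exact ⟨Sum.inl e, by rw [constraint_inl]; linarith⟩
  · push Not at hneg
    obtain ⟨e, he⟩ : ∃ e, d e ≠ 0 := by
      by_contra! h; exact hd0 (funext h)
    induction e with | _ u v
    refine ⟨Sum.inr (Sum.inl ⟨{u, v}, by simp⟩), ?_⟩
    rw [constraint_inside]
    exact sum_pos' (fun e _ => hneg e)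
      ⟨s(u, v), mk_mem_inside.2 (by simp), lt_of_le_of_ne (hneg _) he.symm⟩

theorem IsFeasible.exists_sparse (hM : ∀ A ∈ M, ∀ B ∈ M, Disjoint A B ∨ A ⊆ B ∨ B ⊆ A)
    (c : Sym2 V → ℝ) (hy : IsFeasible F M K b y) :
    ∃ z, IsFeasible F M K b z ∧ ∑ e, c e * z e ≤ ∑ e, c e * y e ∧
      (frac z = ∅ ∨ ∃ A ∈ K, #(frac z ∩ crossing A) ≤ 3) := by
  induction hn : #(univ.filter fun i => constraint K i y ≠ bound b K i)
    using Nat.strong_induction_on generalizing y with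
  | _ n ih
  by_cases hdone : frac y = ∅ ∨ ∃ A ∈ K, #(frac y ∩ crossing A) ≤ 3
  · exact ⟨y, hy, le_rfl, hdone⟩
  push Not at hdone
  obtain ⟨hne, h4⟩ := hdone
  obtain ⟨d, hd0, hd, hins, hcr⟩ := exists_direction hy.forest hy.tight_univ hne hM hy.tight
    (K := K.filter fun A => ∑ e ∈ crossing A, y e = b A) ((filter_subset _ _).trans hy.subset)
    (fun A hA => ⟨b A, (mem_filter.1 hA).2.symm⟩) fun A hA => h4 A (mem_filter.1 hA).1
  wlog hcd : ∑ e, c e * d e ≤ 0 generalizing d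
  · refine this (-d) (neg_ne_zero.2 hd0) (fun e he => by simp [hd e he])
      (fun U hU => by simp [hins U hU]) (fun A hA => by simp [hcr A hA]) ?_
    simp only [Pi.neg_apply, mul_neg, sum_neg_distrib]
    linarith
  obtain ⟨t, ht, hle, hlt⟩ := exists_step (constraint K) (bound b K) hy.constraint_le (d := d) (by
    rintro (e | U | A) h
    · rw [constraint_inl] at h ⊢
      rw [hd e fun hf => (mem_frac.1 hf).1.ne' (neg_eq_zero.1 h), neg_zero]
    · rw [constraint_inside] at h ⊢
      exact hins U.1 ⟨U.2, h⟩
    · rw [constraint_crossing] at h ⊢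
      exact hcr A.1 (mem_filter.2 ⟨A.2, h⟩)) (exists_constraint_pos hd0)
  obtain ⟨z, hz, hcz, hfin⟩ := ih _ (hn ▸ hlt) (hy.add_smul hd hins hle) rfl
  refine ⟨z, hz, hcz.trans ?_, hfin⟩
  have : ∑ e, c e * (y + t • d) e = ∑ e, c e * y e + t * ∑ e, c e * d e := by
    rw [mul_sum, ← sum_add_distrib]
    exact sum_congr rfl fun e _ => by simp; ring
  rw [this]
  nlinarith

theorem IsFeasible.drop (hy : IsFeasible F M K b y) {A : Finset V} (hA : A ∈ K)
    (h3 : #(frac y ∩ crossing A) ≤ 3) : IsFeasible F M (K.erase A) b y := by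
  refine ⟨hy.forest, hy.tight_univ, hy.support, hy.tight, (erase_subset _ _).trans hy.subset,
    fun B hB => hy.sum_le B (mem_of_mem_erase hB), fun B hB hBK => ?_⟩
  by_cases hBA : B = A
  swap
  · exact hy.card_le B hB fun h => hBK (mem_erase.2 ⟨hBA, h⟩)
  subst hBA
  set O := (crossing B).filter fun e => y e = 1
  have hsplit : ((crossing B).filter fun e => 0 < y e) = (frac y ∩ crossing B) ∪ O := by
    ext e
    have h0 := hy.forest.le_one e
    simp only [O, mem_filter, mem_union, mem_inter, mem_frac]
    constructor
    · rintro ⟨h1, h2⟩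
      rcases h0.lt_or_eq with h | h
      · exact Or.inl ⟨⟨h2, h⟩, h1⟩
      · exact Or.inr ⟨h1, h⟩
    · rintro (⟨h1, h2⟩ | ⟨h1, h2⟩)
      · exact ⟨h2, h1.1⟩
      · exact ⟨h1, by rw [h2]; exact one_pos⟩
  have hdisj : Disjoint (frac y ∩ crossing B) O := by
    rw [Finset.disjoint_left]
    intro e h1 h2
    exact (mem_frac.1 (mem_inter.1 h1).1).2.ne (mem_filter.1 h2).2
  have hO : ∑ e ∈ O, y e = #O := by
    rw [sum_congr rfl fun e he => (mem_filter.1 he).2, sum_const, nsmul_one]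
  have hle : ∑ e ∈ frac y ∩ crossing B, y e + #O ≤ b B := by
    rw [← hO, ← sum_union hdisj, ← hsplit]
    exact (sum_le_sum_of_subset_of_nonneg (filter_subset _ _) fun e _ _ =>
      hy.forest.nonneg e).trans (hy.sum_le B hA)
  rw [hsplit, card_union_of_disjoint hdisj]
  rcases (frac y ∩ crossing B).eq_empty_or_nonempty with h | h
  · rw [h, sum_empty, zero_add] at hle
    have : (#O : ℤ) ≤ b B := by exact_mod_cast hle
    rw [h]
    simp
    omega
  · have hpos : 0 < ∑ e ∈ frac y ∩ crossing B, y e :=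
      sum_pos (fun e he => (mem_frac.1 (mem_inter.1 he).1).1) h
    have : (#O : ℝ) < b B := by linarith
    have : (#O : ℤ) < b B := by exact_mod_cast this
    push_cast
    omega

/-- Iterative relaxation ends at an integral point. -/
theorem IsFeasible.exists_integral (hM : ∀ A ∈ M, ∀ B ∈ M, Disjoint A B ∨ A ⊆ B ∨ B ⊆ A)
    (c : Sym2 V → ℝ) (hy : IsFeasible F M K b y) :
    ∃ z, ∃ K', IsFeasible F M K' b z ∧ ∑ e, c e * z e ≤ ∑ e, c e * y e ∧ frac z = ∅ := by
  induction K using Finset.strongInduction generalizing y with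
  | H K ih =>
    obtain ⟨z, hz, hcz, h | ⟨A, hA, h3⟩⟩ := hy.exists_sparse hM c
    · exact ⟨z, K, hz, hcz, h⟩
    · obtain ⟨w, K', hw, hcw, hf⟩ := ih _ (erase_ssubset hA) (hz.drop hA h3)
      exact ⟨w, K', hw, hcw.trans hcz, hf⟩

end Relaxation

section Trees

variable [Fintype V]

theorem sum_sym2_subtype (S : Set V) [Fintype S] (f : Sym2 V → ℝ) :
    ∑ e : Sym2 S, f (e.map Subtype.val) = ∑ e ∈ inside S.toFinset, f e := by
  refine sum_nbij (fun e => e.map Subtype.val) (fun e _ => ?_)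
    (Sym2.map.injective Subtype.val_injective).injOn (fun e he => ?_) fun _ _ => rfl
  · induction e with | _ a b
    exact mk_mem_inside.2 (by simp)
  · induction e with | _ a b
    rw [mem_coe, mk_mem_inside, Set.mem_toFinset, Set.mem_toFinset] at he
    exact ⟨s(⟨a, he.1⟩, ⟨b, he.2⟩), by simp⟩

theorem sum_edgeSet_of_isTree {T : SimpleGraph V} (hT : T.IsTree) :
    ∑ e, (if e ∈ T.edgeSet then 1 else 0 : ℝ) = Fintype.card V - 1 := by
  rw [← hT.card_edgeFinset, sum_boole]
  push_cast
  rw [add_sub_cancel_right]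
  congr 2
  ext e
  simp

theorem sum_edgeSet_le_of_isAcyclic [Nonempty V] {T : SimpleGraph V} (hT : T.IsAcyclic) :
    ∑ e, (if e ∈ T.edgeSet then 1 else 0 : ℝ) ≤ Fintype.card V - 1 := by
  obtain ⟨F, hTF, -, hF⟩ := SimpleGraph.connected_top.exists_isTree_le_of_le_of_isAcyclic le_top hT
  rw [← sum_edgeSet_of_isTree hF]
  refine sum_le_sum fun e _ => ?_
  by_cases he : e ∈ T.edgeSet
  · rw [if_pos he, if_pos (SimpleGraph.edgeSet_mono hTF he)]
  · rw [if_neg he]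
    split_ifs <;> norm_num

theorem inside_univ : inside (univ : Finset V) = univ := by
  ext e; simp [mem_inside]

theorem isForestPoint_of_isTree {T : SimpleGraph V} (hT : T.IsTree) :
    IsForestPoint fun e => if e ∈ T.edgeSet then (1 : ℝ) else 0 := by
  refine ⟨fun e => ?_, fun e he => if_neg fun h => T.not_isDiag_of_mem_edgeSet h he,
    fun U hU => ?_⟩
  · split_ifs <;> norm_num
  · have := hU.coe_sort
    have h := sum_edgeSet_le_of_isAcyclic (hT.isAcyclic.induce (U : Set V))
    have hs := sum_sym2_subtype (U : Set V) fun e => if e ∈ T.edgeSet then (1 : ℝ) else 0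
    rw [Finset.toFinset_coe] at hs
    rw [← hs]
    convert h using 2
    · rename_i e _
      congr 1
      induction e with | _ a b
      simp
    · simp

theorem of_mem_stPolytope {G : SimpleGraph V} {x : Sym2 V → ℝ} (hx : x ∈ stPolytope G) :
    IsForestPoint x ∧ IsTight x univ ∧ ∀ e ∉ G.edgeSet, x e = 0 := by
  refine convexHull_min (s := {y | ∃ T : SimpleGraph V, T ≤ G ∧ T.IsTree ∧
      y = fun e => if e ∈ T.edgeSet then (1 : ℝ) else 0})
    (t := {y | IsForestPoint y ∧ IsTight y univ ∧ ∀ e ∉ G.edgeSet, y e = 0}) ?_ ?_ hx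
  · rintro _ ⟨T, hTG, hT, rfl⟩
    have := hT.nonempty
    refine ⟨isForestPoint_of_isTree hT, ⟨univ_nonempty, ?_⟩,
      fun e he => if_neg fun h => he (SimpleGraph.edgeSet_mono hTG h)⟩
    rw [inside_univ, sum_edgeSet_of_isTree hT, card_univ]
  · rintro y ⟨hy, hyu, hyG⟩ z ⟨hz, hzu, hzG⟩ a b ha hb hab
    have hsum : ∀ U : Finset V, ∑ e ∈ inside U, (a • y + b • z) e =
        a * ∑ e ∈ inside U, y e + b * ∑ e ∈ inside U, z e := fun U => by
      simp [sum_add_distrib, mul_sum]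
    refine ⟨⟨fun e => ?_, fun e he => ?_, fun U hU => ?_⟩, ⟨hyu.1, ?_⟩, fun e he => ?_⟩
    · exact add_nonneg (mul_nonneg ha (hy.nonneg e)) (mul_nonneg hb (hz.nonneg e))
    · simp [hy.diag e he, hz.diag e he]
    · rw [hsum]
      calc _ ≤ a * (#U - 1 : ℝ) + b * (#U - 1) :=
            add_le_add (mul_le_mul_of_nonneg_left (hy.sum_inside_le U hU) ha)
              (mul_le_mul_of_nonneg_left (hz.sum_inside_le U hU) hb)
        _ = _ := by rw [← add_mul, hab, one_mul]
    · rw [hsum, hyu.2, hzu.2, ← add_mul, hab, one_mul]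
    · simp [hyG e he, hzG e he]

theorem IsAligned.isTight {G : SimpleGraph V} {L : Set (Set V)} {x : Sym2 V → ℝ}
    (hx : IsAligned G L x) {S : Finset V} (hS : (S : Set V) ∈ L) : IsTight x S := by
  have hmem : (fun e : Sym2 (S : Set V) => x (e.map Subtype.val)) ∈
      stPolytope (G.induce (S : Set V)) := by convert hx S hS
  obtain ⟨-, ⟨⟨v, -⟩, h⟩, -⟩ := of_mem_stPolytope hmem
  refine ⟨⟨v, v.2⟩, ?_⟩
  rw [inside_univ, sum_sym2_subtype (S : Set V) x, Finset.toFinset_coe] at h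
  simpa using h

theorem sum_cutEdges {G : SimpleGraph V} {x : Sym2 V → ℝ} (hx : ∀ e ∉ G.edgeSet, x e = 0)
    (S : Finset V) : ∑ e ∈ cutEdges G S, x e = ∑ e ∈ crossing S, x e := by
  simp only [cutEdges, crossing, mem_coe]
  refine sum_subset (fun e => ?_) fun e he hne => hx e fun heG => hne ?_
  · simp only [mem_filter]
    exact fun h => ⟨h.1, h.2.2⟩
  · simp only [mem_filter] at he ⊢
    exact ⟨he.1, heG, he.2⟩

/-- An integral point satisfying all constraints is the indicator of a spanning tree. -/
theorem exists_isTree_of_integral [Nonempty V] {z : Sym2 V → ℝ} (hz : IsForestPoint z)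
    (hu : IsTight z univ) (hf : frac z = ∅) :
    ∃ T : SimpleGraph V, T.IsTree ∧ ∀ e, e ∈ T.edgeSet ↔ z e = 1 := by
  have h01 : ∀ e, z e = 0 ∨ z e = 1 := fun e => hz.eq_zero_or_one (by simp [hf])
  obtain ⟨T, hT⟩ : ∃ T : SimpleGraph V, ∀ e, e ∈ T.edgeSet ↔ z e = 1 := by
    refine ⟨SimpleGraph.fromEdgeSet {e | z e = 1}, fun e => ?_⟩
    rw [SimpleGraph.edgeSet_fromEdgeSet, Set.mem_sdiff, Set.mem_ofPred_eq]
    refine and_iff_left_of_imp fun h hd => ?_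
    rw [hz.diag e hd] at h
    exact zero_ne_one h
  refine ⟨T, SimpleGraph.isTree_iff_connected_and_card.2 ⟨⟨fun u v => ?_⟩, ?_⟩, hT⟩
  · by_contra hr
    set U := univ.filter fun w => T.Reachable u w
    have hU : U ⊂ univ := ssubset_univ_iff.2 fun h => hr (by simpa [U] using h.ge (mem_univ v))
    have h1 := hz.one_le_sum_crossing hu ⟨u, by simp [U]⟩ hU
    obtain ⟨e, he, hne⟩ := exists_ne_zero_of_sum_ne_zero (one_pos.trans_le h1).ne'
    have hab := (hT e).2 ((h01 e).resolve_left hne)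
    obtain ⟨a, b, rfl, ha, hb⟩ := (mem_filter.1 (mem_filter.1 he).2).2
    simp only [U, mem_filter, mem_univ, true_and] at ha hb
    exact hb (ha.trans (T.mem_edgeSet.1 hab).reachable)
  · have h := hu.2
    have hind : ∀ e, z e = if z e = 1 then 1 else 0 := fun e => by
      rcases h01 e with h | h <;> simp [h]
    rw [inside_univ, sum_congr rfl fun e _ => hind e, sum_boole, card_univ, eq_sub_iff_add_eq] at h
    rw [Nat.card_eq_fintype_card, Nat.card_eq_fintype_card, Fintype.card_subtype]
    simp only [hT]
    exact_mod_cast h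

end Trees

/-- Laminar thin trees for `L`-aligned points. -/
theorem laminar_thin_tree_aligned [Fintype V] (G : SimpleGraph V) (hG : G.Connected)
    (L : Set (Set V)) (hL : Laminar L)
    (c : Sym2 V → ℝ) (hc : ∀ e, 0 ≤ c e)
    (x : Sym2 V → ℝ) (hx : x ∈ stPolytope G) (hal : IsAligned G L x) :
    ∃ T : SimpleGraph V, T ≤ G ∧ T.IsTree ∧
      (∑ e ∈ T.edgeFinset, c e) ≤ ∑ e ∈ G.edgeFinset, c e * x e ∧
      ∀ S ∈ L, ((T.edgeFinset ∩ cutEdges G S).card : ℝ) ≤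
          2 * ⌈∑ e ∈ cutEdges G S, x e⌉ + 1 ∧
        (2 * (⌈∑ e ∈ cutEdges G S, x e⌉ : ℝ) + 1) ≤ 2 * (∑ e ∈ cutEdges G S, x e) + 3 := by
  have := hG.nonempty
  obtain ⟨hxf, hxu, hxG⟩ := of_mem_stPolytope hx
  set M : Finset (Finset V) := univ.filter fun S => (S : Set V) ∈ L
  have hML : ∀ S, S ∈ M ↔ (S : Set V) ∈ L := by simp [M]
  have hM : ∀ A ∈ M, ∀ B ∈ M, Disjoint A B ∨ A ⊆ B ∨ B ⊆ A := by
    intro A hA B hB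
    rw [Finset.disjoint_iff_inter_eq_empty, ← inter_eq_left, ← inter_eq_right]
    exact_mod_cast hL A B ((hML A).1 hA) ((hML B).1 hB)
  set b : Finset V → ℤ := fun S => ⌈∑ e ∈ crossing S, x e⌉
  have hfeas : IsFeasible (univ.filter (· ∈ G.edgeSet)) M M b x :=
    ⟨hxf, hxu, fun e he => hxG e (by simpa using he), fun A hA => hal.isTight ((hML A).1 hA),
      subset_rfl, fun A _ => Int.le_ceil _, fun A h1 h2 => absurd h1 h2⟩
  obtain ⟨z, K, hz, hcz, hfrac⟩ := hfeas.exists_integral hM c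
  obtain ⟨T, hT, hTz⟩ := exists_isTree_of_integral hz.forest hz.tight_univ hfrac
  have hz0 : ∀ e ∉ T.edgeSet, z e = 0 := fun e he =>
    (hz.forest.eq_zero_or_one (by simp [hfrac])).resolve_right (mt (hTz e).2 he)
  have hTG : T ≤ G := SimpleGraph.edgeSet_subset_edgeSet.1 fun e he => by
    by_contra h
    exact zero_ne_one ((hz.support e (by simpa using h)).symm.trans ((hTz e).1 he))
  refine ⟨T, hTG, hT, ?_, fun S' hS' => ?_⟩
  · calc ∑ e ∈ T.edgeFinset, c e = ∑ e ∈ T.edgeFinset, c e * z e :=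
          sum_congr rfl fun e he => by
            rw [(hTz e).1 (SimpleGraph.mem_edgeFinset.1 he), mul_one]
      _ = ∑ e, c e * z e := sum_subset (subset_univ _) fun e _ he => by
            rw [hz0 e (mt SimpleGraph.mem_edgeFinset.2 he), mul_zero]
      _ ≤ ∑ e, c e * x e := hcz
      _ = ∑ e ∈ G.edgeFinset, c e * x e := (sum_subset (subset_univ _) fun e _ he => by
            rw [hxG e (mt SimpleGraph.mem_edgeFinset.2 he), mul_zero]).symm
  · obtain ⟨S, rfl⟩ : ∃ S : Finset V, (S : Set V) = S' := ⟨S'.toFinset, by simp⟩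
    rw [sum_cutEdges hxG]
    have hceil := Int.ceil_lt_add_one (∑ e ∈ crossing S, x e)
    refine ⟨?_, by linarith⟩
    have hsub : T.edgeFinset ∩ cutEdges G S ⊆ (crossing S).filter fun e => 0 < z e := by
      intro e he
      simp only [cutEdges, crossing, mem_coe, mem_inter, mem_filter,
        SimpleGraph.mem_edgeFinset] at he ⊢
      exact ⟨⟨he.2.1, he.2.2.2⟩, by rw [(hTz e).1 he.1]; exact one_pos⟩
    have hcard : #(T.edgeFinset ∩ cutEdges G S) ≤ 2 * b S + 1 := by
      refine le_trans (Nat.cast_le.2 (card_le_card hsub)) ?_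
      have hb : 0 ≤ b S := Int.ceil_nonneg (sum_nonneg fun e _ => hxf.nonneg e)
      by_cases hSK : S ∈ K
      · have hle := hz.sum_le S hSK
        have hsum : (#((crossing S).filter fun e => 0 < z e) : ℝ) ≤ ∑ e ∈ crossing S, z e := by
          rw [card_eq_sum_ones, sum_filter, Nat.cast_sum]
          refine sum_le_sum fun e _ => ?_
          rcases hz.forest.eq_zero_or_one (e := e) (by simp [hfrac]) with h | h <;> simp [h]
        have : (#((crossing S).filter fun e => 0 < z e) : ℤ) ≤ b S := by
          exact_mod_cast hsum.trans hle
        omega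
      · have h2 := hz.card_le S ((hML S).2 hS') hSK
        rcases eq_or_ne S univ with rfl | hne
        · rw [show crossing (univ : Finset V) = ∅ by simp [crossing]]
          simpa using by omega
        · have h1 := hxf.one_le_sum_crossing hxu (hal.isTight hS').1 (ssubset_univ_iff.2 hne)
          have : 0 < b S := Int.ceil_pos.2 (one_pos.trans_le (h1.trans
            (sum_le_sum_of_subset_of_nonneg (fun e he => (mem_filter.1 he).2)
              fun e _ _ => hxf.nonneg e)))
          omega
    exact_mod_cast hcard
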